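/- Let B > 0, τ > 0 and s ∈ ℝ. The infinite matrix indexed by m,n ∈ ℕ∪{0} whose (m,n)-entry is ∫₀^s e^{2iBτ(m−n)u}·Q(u)_{mn} du defines a bounded linear operator on ℓ²(ℕ∪{0}) whose operator norm is at most (1 + ((1+√2)/8)·|s|)·π²/(6Bτ). -/

import Mathlib

/-- `γ_n(s) = (Γ(n+|s|+1)/n!)^{1/2}`. -/
noncomputable def gammaCoef (s : ℝ) (n : ℕ) : ℝ :=
  Real.sqrt (Real.Gamma ((n : ℝ) + |s| + 1) / (Nat.factorial n : ℝ))

/-- The matrix `Q(u)`, indexed by `m, n ∈ ℕ ∪ {0}`. -/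
noncomputable def Qmat (u : ℝ) (m n : ℕ) : ℂ :=
  if m = n then 0
  else (Complex.I * (Real.sign u : ℝ) / (2 * (((n : ℝ) : ℂ) - ((m : ℝ) : ℂ)))) *
    ((min (gammaCoef u m / gammaCoef u n) (gammaCoef u n / gammaCoef u m) : ℝ) : ℂ)

/-- The oscillatory integral of a differentiable, nonnegative, antitone amplitude bounded by `1`. -/
theorem norm_integral_exp_mul_antitone_le {q : ℝ → ℝ} {s ω : ℝ} (hs : 0 ≤ s) (hω : ω ≠ 0)
    (hd : ∀ u, 0 ≤ u → DifferentiableAt ℝ q u) (hanti : AntitoneOn q (Set.Ici 0))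
    (h0 : q 0 ≤ 1) (hpos : ∀ u, 0 ≤ u → 0 ≤ q u) :
    ‖∫ u in (0 : ℝ)..s, Complex.exp (Complex.I * ω * u) * (q u : ℂ)‖ ≤ 2 / |ω| := by
  have hω' : (Complex.I * ω : ℂ) ≠ 0 := mul_ne_zero Complex.I_ne_zero (by exact_mod_cast hω)
  have hmem : ∀ x ∈ Set.uIcc 0 s, 0 ≤ x := fun x hx ↦ by
    rw [Set.uIcc_of_le hs] at hx; exact hx.1
  have hq' : ∀ x ∈ Set.uIcc 0 s, HasDerivAt q (deriv q x) x := fun x hx ↦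
    (hd x (hmem x hx)).hasDerivAt
  have hneg : ∀ x, 0 < x → deriv q x ≤ 0 := fun x hx ↦ by
    rw [← derivWithin_of_mem_nhds (Ici_mem_nhds hx)]
    exact hanti.derivWithin_nonpos
  have hq_int : IntervalIntegrable (deriv q) MeasureTheory.volume 0 s := by
    have := intervalIntegral.intervalIntegrable_deriv_of_nonneg (a := 0) (b := s)
      (g := fun x ↦ -q x) (g' := fun x ↦ -deriv q x)
      (fun x hx ↦ (hq' x hx).continuousAt.neg.continuousWithinAt)
      (fun x hx ↦ (hq' x ⟨hx.1.le, hx.2.le⟩).neg)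
      (fun x hx ↦ by
        rw [min_eq_left hs] at hx
        exact neg_nonneg.2 (hneg x hx.1))
    simpa [Pi.neg_def] using this.neg
  have hexp : ∀ x : ℝ, ‖Complex.exp (Complex.I * ω * x) / (Complex.I * ω)‖ = 1 / |ω| := fun x ↦ by
    have h := Complex.norm_exp_ofReal_mul_I (ω * x)
    have e : Complex.I * ω * x = ((ω * x : ℝ) : ℂ) * Complex.I := by push_cast; ring
    rw [norm_div, e, h]
    simp
  have hv : ∀ x ∈ Set.uIcc 0 s, HasDerivAt
      (fun x : ℝ ↦ Complex.exp (Complex.I * ω * x) / (Complex.I * ω))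
      (Complex.exp (Complex.I * ω * x)) x := fun x _ ↦ by
    have h1 : HasDerivAt (fun x : ℝ ↦ Complex.I * ω * x) (Complex.I * ω) x := by
      simpa using (Complex.ofRealCLM.hasDerivAt (x := x)).const_mul (Complex.I * ω : ℂ)
    have := h1.cexp.div_const (Complex.I * ω)
    rwa [mul_div_cancel_right₀ _ hω'] at this
  have key := intervalIntegral.integral_mul_deriv_eq_deriv_mul (a := 0) (b := s)
    (u := fun x ↦ (q x : ℂ)) (u' := fun x ↦ ((deriv q x : ℝ) : ℂ))
    (fun x hx ↦ (hq' x hx).ofReal_comp) hv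
    ⟨hq_int.1.ofReal, hq_int.2.ofReal⟩
    ((by fun_prop : Continuous fun x : ℝ ↦ Complex.exp (Complex.I * ω * x)).intervalIntegrable _ _)
  have hlast : ‖∫ x in (0 : ℝ)..s,
      ((deriv q x : ℝ) : ℂ) * (Complex.exp (Complex.I * ω * x) / (Complex.I * ω))‖
        ≤ (q 0 - q s) * (1 / |ω|) := by
    have h := intervalIntegral.norm_integral_le_of_norm_le hs
      (f := fun x : ℝ ↦
        ((deriv q x : ℝ) : ℂ) * (Complex.exp (Complex.I * ω * x) / (Complex.I * ω)))
      (g := fun x ↦ -deriv q x * (1 / |ω|)) (μ := MeasureTheory.volume)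
      (Filter.Eventually.of_forall fun x hx ↦ by
        rw [norm_mul, hexp, Complex.norm_real, Real.norm_eq_abs, abs_of_nonpos (hneg x hx.1)])
      (hq_int.neg.mul_const _)
    rw [intervalIntegral.integral_mul_const, intervalIntegral.integral_neg,
      intervalIntegral.integral_eq_sub_of_hasDerivAt hq' hq_int, neg_sub] at h
    exact h
  simp_rw [mul_comm (Complex.exp _)]
  rw [key]
  have n1 := hpos s hs
  have n0 := hpos 0 le_rfl
  calc _ ≤ q s * (1 / |ω|) + q 0 * (1 / |ω|) + (q 0 - q s) * (1 / |ω|) := by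
        refine (norm_sub_le _ _).trans ?_
        refine add_le_add ((norm_sub_le _ _).trans_eq ?_) hlast
        simp only [norm_mul, hexp, Complex.norm_real, Real.norm_eq_abs, abs_of_nonneg n1,
          abs_of_nonneg n0]
    _ = q 0 * (2 / |ω|) := by ring
    _ ≤ 2 / |ω| := mul_le_of_le_one_left (by positivity) h0

/-- The product representing `γ_m(u) / γ_n(u)` for `m ≤ n` and `u ≥ 0`. -/
noncomputable def gammaRatio (m n : ℕ) (u : ℝ) : ℝ :=
  ∏ k ∈ Finset.Ico m n, Real.sqrt (((k : ℝ) + 1) / ((k : ℝ) + 1 + u))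

theorem gammaCoef_pos (s : ℝ) (n : ℕ) : 0 < gammaCoef s n := by
  unfold gammaCoef
  have := Real.Gamma_pos_of_pos (s := (n : ℝ) + |s| + 1) (by positivity)
  positivity

theorem gammaCoef_eq_sqrt_mul_succ (s : ℝ) (n : ℕ) :
    gammaCoef s n = Real.sqrt (((n : ℝ) + 1) / ((n : ℝ) + 1 + |s|)) * gammaCoef s (n + 1) := by
  unfold gammaCoef
  rw [← Real.sqrt_mul (by positivity)]
  congr 1
  have e : ((n + 1 : ℕ) : ℝ) + |s| + 1 = ((n : ℝ) + |s| + 1) + 1 := by push_cast; ring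
  have hp : (n : ℝ) + |s| + 1 ≠ 0 := by positivity
  have hp' : (n : ℝ) + 1 + |s| ≠ 0 := by positivity
  rw [e, Real.Gamma_add_one hp, Nat.factorial_succ]
  push_cast
  field_simp
  ring

theorem gammaCoef_eq_gammaRatio_mul (s : ℝ) {m n : ℕ} (h : m ≤ n) :
    gammaCoef s m = gammaRatio m n |s| * gammaCoef s n := by
  induction n, h using Nat.le_induction with
  | base => simp [gammaRatio]
  | succ n h ih =>
    rw [ih, gammaRatio, gammaRatio, Finset.prod_Ico_succ_top h, mul_assoc,
      ← gammaCoef_eq_sqrt_mul_succ]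

theorem gammaRatio_nonneg (m n : ℕ) (u : ℝ) : 0 ≤ gammaRatio m n u :=
  Finset.prod_nonneg fun _ _ ↦ Real.sqrt_nonneg _

theorem gammaRatio_antitoneOn (m n : ℕ) : AntitoneOn (gammaRatio m n) (Set.Ici 0) := by
  intro x (hx : 0 ≤ x) y _ hxy
  refine Finset.prod_le_prod (fun _ _ ↦ Real.sqrt_nonneg _) fun k _ ↦ Real.sqrt_le_sqrt ?_
  gcongr

theorem gammaRatio_zero (m n : ℕ) : gammaRatio m n 0 = 1 := by
  refine Finset.prod_eq_one fun k _ ↦ ?_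
  have : (k : ℝ) + 1 ≠ 0 := by positivity
  simp [this]

theorem gammaRatio_le_one (m n : ℕ) {u : ℝ} (hu : 0 ≤ u) : gammaRatio m n u ≤ 1 :=
  gammaRatio_zero m n ▸ gammaRatio_antitoneOn m n Set.self_mem_Ici hu hu

theorem gammaRatio_differentiableAt (m n : ℕ) {u : ℝ} (hu : 0 ≤ u) :
    DifferentiableAt ℝ (gammaRatio m n) u := by
  unfold gammaRatio
  refine DifferentiableAt.fun_finsetProd fun k _ ↦ DifferentiableAt.sqrt ?_ (by positivity)
  have : (k : ℝ) + 1 + u ≠ 0 := by positivity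
  fun_prop (disch := assumption)

theorem min_gammaCoef_div (u : ℝ) (m n : ℕ) :
    min (gammaCoef u m / gammaCoef u n) (gammaCoef u n / gammaCoef u m) =
      gammaRatio (min m n) (max m n) |u| := by
  wlog h : m ≤ n generalizing m n
  · rw [min_comm, this n m (le_of_not_ge h), min_comm, max_comm]
  have hn := gammaCoef_pos u n
  have hm := gammaCoef_pos u m
  have e := gammaCoef_eq_gammaRatio_mul u h
  have h1 := gammaRatio_le_one m n (abs_nonneg u)
  have hle : gammaCoef u m ≤ gammaCoef u n := e ▸ mul_le_of_le_one_left hn.le h1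
  have e' : gammaCoef u m / gammaCoef u n = gammaRatio m n |u| := by
    rw [div_eq_iff hn.ne', e]
  rw [min_eq_left h, max_eq_right h, min_eq_left, e']
  exact ((div_le_one hn).2 hle).trans ((one_le_div hm).2 hle)

theorem norm_integral_exp_mul_Qmat_le {B τ : ℝ} (s : ℝ) (hB : 0 < B) (hτ : 0 < τ) (m n : ℕ) :
    ‖∫ u in (0 : ℝ)..s,
        Complex.exp (2 * Complex.I * B * τ * (((m : ℝ) : ℂ) - ((n : ℝ) : ℂ)) * u) * Qmat u m n‖ ≤
      1 / (2 * B * τ) * (1 / ((m : ℝ) - n) ^ 2) := by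
  rcases eq_or_ne m n with rfl | hmn
  · simp [Qmat]
  have hmn' : (m : ℝ) - n ≠ 0 := sub_ne_zero.2 (by exact_mod_cast hmn)
  have bound : ∀ (c : ℂ) (ω t : ℝ), ‖c‖ = 1 / (2 * |(m : ℝ) - n|) → 0 ≤ t →
      |ω| = 2 * B * τ * |(m : ℝ) - n| →
      ‖∫ u in (0 : ℝ)..t, c * (Complex.exp (Complex.I * ω * u) *
        (gammaRatio (min m n) (max m n) u : ℂ))‖ ≤
      1 / (2 * B * τ) * (1 / ((m : ℝ) - n) ^ 2) := by
    intro c ω t hc ht hω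
    have hpos : 0 < |(m : ℝ) - n| := abs_pos.2 hmn'
    have hω0 : ω ≠ 0 := abs_pos.1 (hω ▸ by positivity)
    rw [intervalIntegral.integral_const_mul, norm_mul, hc]
    have h := norm_integral_exp_mul_antitone_le ht hω0
      (fun u hu ↦ gammaRatio_differentiableAt (min m n) (max m n) hu)
      (gammaRatio_antitoneOn _ _) (gammaRatio_zero _ _).le (fun u _ ↦ gammaRatio_nonneg _ _ u)
    refine (mul_le_mul_of_nonneg_left h (by positivity)).trans_eq ?_
    rw [hω, ← sq_abs ((m : ℝ) - n)]
    field_simp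
  have hnorm : ∀ z : ℂ, ‖z‖ = 1 →
      ‖z / (2 * (((n : ℝ) : ℂ) - ((m : ℝ) : ℂ)))‖ = 1 / (2 * |(m : ℝ) - n|) := fun z hz ↦ by
    rw [norm_div, hz, norm_mul, ← Complex.ofReal_sub, Complex.norm_real, Real.norm_eq_abs,
      abs_sub_comm]
    simp
  have habs : ∀ ω : ℝ, |ω| = |2 * B * τ * ((m : ℝ) - n)| → |ω| = 2 * B * τ * |(m : ℝ) - n| :=
    fun ω h ↦ by rw [h, abs_mul, abs_of_pos (by positivity : 0 < 2 * B * τ)]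
  rcases le_total 0 s with hs | hs
  · refine (congrArg norm ?_).trans_le (bound (Complex.I / (2 * (((n : ℝ) : ℂ) - ((m : ℝ) : ℂ)))) _ s
      (hnorm _ (by simp)) hs (habs (2 * B * τ * ((m : ℝ) - n)) rfl))
    refine intervalIntegral.integral_congr_ae (Filter.Eventually.of_forall fun u hu ↦ ?_)
    rw [Set.uIoc_of_le hs] at hu
    rw [Qmat, if_neg hmn, min_gammaCoef_div, abs_of_pos hu.1, Real.sign_of_pos hu.1]
    push_cast
    ring_nf
  · rw [← neg_neg s, ← neg_zero (G := ℝ), ← intervalIntegral.integral_comp_neg,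
      intervalIntegral.integral_symm, norm_neg]
    refine (congrArg norm ?_).trans_le (bound (-Complex.I / (2 * (((n : ℝ) : ℂ) - ((m : ℝ) : ℂ)))) _ (-s)
      (hnorm _ (by simp)) (by linarith) (habs (-(2 * B * τ * ((m : ℝ) - n))) (abs_neg _)))
    refine intervalIntegral.integral_congr_ae (Filter.Eventually.of_forall fun u hu ↦ ?_)
    rw [Set.uIoc_of_le (by linarith)] at hu
    rw [Qmat, if_neg hmn, min_gammaCoef_div, abs_neg, abs_of_pos hu.1,
      Real.sign_of_neg (by linarith [hu.1])]
    push_cast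
    ring_nf

theorem hasSum_int_one_div_sq : HasSum (fun d : ℤ ↦ 1 / (d : ℝ) ^ 2) (Real.pi ^ 2 / 3) := by
  have h : HasSum (fun n : ℕ ↦ 1 / ((n : ℝ) + 1) ^ 2) (Real.pi ^ 2 / 6) := by
    simpa using (hasSum_nat_add_iff' 1).2 hasSum_zeta_two
  convert HasSum.of_add_one_of_neg_add_one (f := fun d : ℤ ↦ 1 / (d : ℝ) ^ 2)
    (by simpa using h) (by simpa [← neg_add_rev, add_comm] using h) using 1
  simp; ring

theorem summable_and_tsum_one_div_sub_sq_le (m : ℕ) :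
    Summable (fun n : ℕ ↦ 1 / ((m : ℝ) - n) ^ 2) ∧
      ∑' n : ℕ, 1 / ((m : ℝ) - n) ^ 2 ≤ Real.pi ^ 2 / 3 := by
  have hinj : Function.Injective fun n : ℕ ↦ (m : ℤ) - n := fun a b h ↦ by
    simpa using h
  have e : (fun d : ℤ ↦ 1 / (d : ℝ) ^ 2) ∘ (fun n : ℕ ↦ (m : ℤ) - n) =
      fun n : ℕ ↦ 1 / ((m : ℝ) - n) ^ 2 := by
    ext n; simp
  have hs := hasSum_int_one_div_sq
  refine ⟨e ▸ hs.summable.comp_injective hinj, ?_⟩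
  rw [← hs.tsum_eq, ← e]
  exact tsum_comp_le_tsum_of_inj hs.summable (fun _ ↦ by positivity) hinj

/-- **Schur's test** on `ℓ²(ℕ)`. -/
theorem exists_clm_of_schur {K : ℕ → ℕ → ℂ} {C : ℝ} (hC : 0 ≤ C)
    (hrow : ∀ m, Summable fun n ↦ ‖K m n‖) (hrowC : ∀ m, ∑' n, ‖K m n‖ ≤ C)
    (hcol : ∀ n, Summable fun m ↦ ‖K m n‖) (hcolC : ∀ n, ∑' m, ‖K m n‖ ≤ C) :
    ∃ T : lp (fun _ : ℕ => ℂ) 2 →L[ℂ] lp (fun _ : ℕ => ℂ) 2, ‖T‖ ≤ C ∧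
      ∀ x m, T x m = ∑' n, K m n * x n := by
  have hp : 0 < (2 : ENNReal).toReal := by norm_num
  have hle : ∀ (x : lp (fun _ : ℕ => ℂ) 2) n, ‖x n‖ ≤ ‖x‖ := fun x n ↦
    lp.norm_apply_le_norm two_ne_zero x n
  have hsum1 : ∀ (x : lp (fun _ : ℕ => ℂ) 2) m, Summable fun n ↦ ‖K m n‖ * ‖x n‖ := fun x m ↦
    Summable.of_nonneg_of_le (fun _ ↦ by positivity)
      (fun n ↦ mul_le_mul_of_nonneg_left (hle x n) (norm_nonneg _)) ((hrow m).mul_right ‖x‖)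
  have hsum2 : ∀ (x : lp (fun _ : ℕ => ℂ) 2) m, Summable fun n ↦ ‖K m n‖ * ‖x n‖ ^ 2 :=
    fun x m ↦ Summable.of_nonneg_of_le (fun _ ↦ by positivity)
      (fun n ↦ mul_le_mul_of_nonneg_left (pow_le_pow_left₀ (norm_nonneg _) (hle x n) 2)
        (norm_nonneg _)) ((hrow m).mul_right (‖x‖ ^ 2))
  have hsum : ∀ (x : lp (fun _ : ℕ => ℂ) 2) m, Summable fun n ↦ K m n * x n := fun x m ↦
    Summable.of_norm (by simpa using hsum1 x m)
  have hx2 : ∀ x : lp (fun _ : ℕ => ℂ) 2, HasSum (fun n ↦ ‖x n‖ ^ 2) (‖x‖ ^ 2) := fun x ↦ by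
    simpa using lp.hasSum_norm hp x
  have hpt : ∀ (x : lp (fun _ : ℕ => ℂ) 2) m,
      ‖∑' n, K m n * x n‖ ^ 2 ≤ C * ∑' n, ‖K m n‖ * ‖x n‖ ^ 2 := fun x m ↦ by
    have h1 : ‖∑' n, K m n * x n‖ ≤ ∑' n, ‖K m n‖ * ‖x n‖ := by
      simpa using norm_tsum_le_tsum_norm (f := fun n ↦ K m n * x n) (by simpa using hsum1 x m)
    have h2 : (∑' n, ‖K m n‖ * ‖x n‖) ^ 2 ≤ C * ∑' n, ‖K m n‖ * ‖x n‖ ^ 2 := by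
      refine le_of_tendsto' ((hsum1 x m).hasSum.pow 2) fun F ↦ ?_
      refine (Finset.sum_sq_le_sum_mul_sum_of_sq_le_mul F (f := fun n ↦ ‖K m n‖)
        (g := fun n ↦ ‖K m n‖ * ‖x n‖ ^ 2) (fun _ _ ↦ by positivity) (fun _ _ ↦ by positivity)
        (fun _ _ ↦ le_of_eq (by ring))).trans ?_
      exact mul_le_mul (((hrow m).sum_le_tsum F fun _ _ ↦ norm_nonneg _).trans (hrowC m))
        ((hsum2 x m).sum_le_tsum F fun _ _ ↦ by positivity)
        (Finset.sum_nonneg fun _ _ ↦ by positivity) hC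
    exact (pow_le_pow_left₀ (norm_nonneg _) h1 2).trans h2
  have hbound : ∀ (x : lp (fun _ : ℕ => ℂ) 2) (F : Finset ℕ),
      ∑ m ∈ F, ‖∑' n, K m n * x n‖ ^ (2 : ENNReal).toReal ≤
        (C * ‖x‖) ^ (2 : ENNReal).toReal := fun x F ↦ by
    simp only [ENNReal.toReal_ofNat, Real.rpow_ofNat]
    calc ∑ m ∈ F, ‖∑' n, K m n * x n‖ ^ 2
        ≤ ∑ m ∈ F, C * ∑' n, ‖K m n‖ * ‖x n‖ ^ 2 := Finset.sum_le_sum fun m _ ↦ hpt x m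
      _ = C * ∑' n, ∑ m ∈ F, ‖K m n‖ * ‖x n‖ ^ 2 := by
          rw [← Finset.mul_sum, Summable.tsum_finsetSum fun m _ ↦ hsum2 x m]
      _ ≤ C * ∑' n, C * ‖x n‖ ^ 2 := by
          refine mul_le_mul_of_nonneg_left (Summable.tsum_le_tsum (fun n ↦ ?_)
            (summable_sum fun m _ ↦ hsum2 x m) ((hx2 x).summable.mul_left C)) hC
          rw [← Finset.sum_mul]
          exact mul_le_mul_of_nonneg_right
            (((hcol n).sum_le_tsum F fun _ _ ↦ norm_nonneg _).trans (hcolC n)) (by positivity)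
      _ = (C * ‖x‖) ^ 2 := by
          rw [tsum_mul_left, (hx2 x).tsum_eq]; ring
  let L : lp (fun _ : ℕ => ℂ) 2 →ₗ[ℂ] lp (fun _ : ℕ => ℂ) 2 :=
    { toFun := fun x ↦ ⟨fun m ↦ ∑' n, K m n * x n, memℓp_gen' (hbound x)⟩
      map_add' := fun x y ↦ by
        ext m
        change ∑' n, K m n * (x n + y n) = ∑' n, K m n * x n + ∑' n, K m n * y n
        simpa only [mul_add] using (hsum x m).tsum_add (hsum y m)
      map_smul' := fun c x ↦ by
        ext m
        simpa [mul_left_comm] using tsum_mul_left (a := c) (f := fun n ↦ K m n * x n) }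
  refine ⟨L.mkContinuous C fun x ↦ ?_, L.mkContinuous_norm_le hC _, fun x m ↦ rfl⟩
  exact lp.norm_le_of_forall_sum_le hp (by positivity) (hbound x)

/-- For `B > 0`, `τ > 0` and `s ∈ ℝ`, the matrix with entries
`∫₀^s e^{2iBτ(m−n)u}·Q(u)_{mn} du` defines a bounded linear operator on `ℓ²(ℕ∪{0})`
of operator norm at most `(1 + ((1+√2)/8)|s|)·π²/(6Bτ)`. -/
theorem stmt_17 (B τ s : ℝ) (hB : 0 < B) (hτ : 0 < τ) :
    ∃ T : lp (fun _ : ℕ => ℂ) 2 →L[ℂ] lp (fun _ : ℕ => ℂ) 2,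
      ‖T‖ ≤ (1 + ((1 + Real.sqrt 2) / 8) * |s|) * Real.pi ^ 2 / (6 * B * τ) ∧
      ∀ m n : ℕ,
        @inner ℂ _ _ (lp.single 2 m (1 : ℂ)) (T (lp.single 2 n (1 : ℂ))) =
          ∫ u in (0 : ℝ)..s,
            Complex.exp (2 * Complex.I * B * τ * (((m : ℝ) : ℂ) - ((n : ℝ) : ℂ)) * u) *
              Qmat u m n := by
  set K : ℕ → ℕ → ℂ := fun m n ↦ ∫ u in (0 : ℝ)..s,
    Complex.exp (2 * Complex.I * B * τ * (((m : ℝ) : ℂ) - ((n : ℝ) : ℂ)) * u) * Qmat u m n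
  have hK : ∀ m n, ‖K m n‖ ≤ 1 / (2 * B * τ) * (1 / ((m : ℝ) - n) ^ 2) := fun m n ↦
    norm_integral_exp_mul_Qmat_le s hB hτ m n
  have hK' : ∀ m n, ‖K n m‖ ≤ 1 / (2 * B * τ) * (1 / ((m : ℝ) - n) ^ 2) := fun m n ↦ by
    rw [← neg_sub (n : ℝ) m, neg_sq]
    exact hK n m
  have hsum : ∀ {f : ℕ → ℂ} (m : ℕ),
      (∀ n, ‖f n‖ ≤ 1 / (2 * B * τ) * (1 / ((m : ℝ) - n) ^ 2)) →
      Summable (fun n ↦ ‖f n‖) ∧ ∑' n, ‖f n‖ ≤ Real.pi ^ 2 / (6 * B * τ) := fun m hf ↦ by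
    obtain ⟨h1, h2⟩ := summable_and_tsum_one_div_sub_sq_le m
    have hs := Summable.of_nonneg_of_le (fun _ ↦ norm_nonneg _) hf (h1.mul_left _)
    refine ⟨hs, (hs.tsum_le_tsum hf (h1.mul_left _)).trans ?_⟩
    rw [tsum_mul_left]
    refine (mul_le_mul_of_nonneg_left h2 (by positivity)).trans_eq ?_
    field_simp
    norm_num
  obtain ⟨T, hT, hTK⟩ := exists_clm_of_schur (K := K) (C := Real.pi ^ 2 / (6 * B * τ))
    (by positivity) (fun m ↦ (hsum m (hK m)).1) (fun m ↦ (hsum m (hK m)).2)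
    (fun n ↦ (hsum n (hK' n)).1) (fun n ↦ (hsum n (hK' n)).2)
  refine ⟨T, hT.trans ?_, fun m n ↦ ?_⟩
  · rw [mul_div_assoc]
    exact le_mul_of_one_le_left (by positivity) (le_add_of_nonneg_right (by positivity))
  · rw [lp.inner_single_left, hTK, tsum_eq_single n fun k hk ↦ by
      rw [lp.single_apply_ne _ _ _ hk, mul_zero]]
    simp [K]
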